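/- arXiv:2507.22386 — 2 statements merged into one kernel-verified Lean document; each statement's English description precedes it below -/
import Mathlib

section
/- Let A, B, C, D be four subsets of [n] such that |A| = |B| and |C| = |D|. Fix a permutation w ∈ S_n, and let Q_w denote the set of all pairs (u, v) ∈ S_n × S_n satisfying u(C) = D, v(A) = B and uv = w. Then: if |w(A) ∩ D| ≠ |B ∩ C|, then |Q_w| = 0; and if |w(A) ∩ D| = |B ∩ C|, then |Q_w| = ω_{B,C}. -/
open Finset

/-- The integer `ω_{B,C} = |B∩C|! ⬝ |B∖C|! ⬝ |C∖B|! ⬝ |[n]∖(B∪C)|!`. -/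
def omegaBC {n : ℕ} (B C : Finset (Fin n)) : ℕ :=
  (B ∩ C).card.factorial * (B \ C).card.factorial * (C \ B).card.factorial *
    ((B ∪ C)ᶜ).card.factorial

/-- The number of permutations carrying one colouring to another with equally large colour
classes is the product of the factorials of the sizes of the classes. -/
theorem card_perm_comp_eq {α ι : Type*} [Fintype α] [DecidableEq α] [Fintype ι] [DecidableEq ι]
    (f g : α → ι)
    (h : ∀ i, (univ.filter (fun a => f a = i)).card = (univ.filter (fun a => g a = i)).card) :
    (univ.filter (fun u : Equiv.Perm α => g ∘ u = f)).card =
      ∏ i, (univ.filter (fun a => f a = i)).card.factorial := by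
  have e (i : ι) : Nonempty ({a // f a = i} ≃ {a // g a = i}) := by
    rw [← Fintype.card_eq, Fintype.card_subtype, Fintype.card_subtype, h]
  let u₀ : Equiv.Perm α := Equiv.ofFiberEquiv (fun i => (e i).some)
  have hu₀ (a : α) : g (u₀ a) = f a := Equiv.ofFiberEquiv_map _ a
  have hstab := DomMulAct.stabilizer_card f
  simp only [Fintype.card_subtype] at hstab
  rw [← hstab]
  refine card_equiv (Equiv.mulLeft u₀⁻¹) fun u => ?_
  have hg (b : α) : g b = f (u₀⁻¹ b) := by rw [← hu₀, Equiv.Perm.inv_def, Equiv.apply_symm_apply]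
  simp only [mem_filter_univ, Equiv.coe_mulLeft, funext_iff, Function.comp_apply,
    Equiv.Perm.mul_apply, hg]

/-- The classes of the partition of `α` according to membership in `B` and in `C`. -/
theorem filter_mem_pair_eq {α : Type*} [Fintype α] [DecidableEq α] (B C : Finset α)
    (i : Bool × Bool) :
    univ.filter (fun a => (decide (a ∈ B), decide (a ∈ C)) = i) =
      match i with
      | (true, true) => B ∩ C
      | (true, false) => B \ C
      | (false, true) => C \ B
      | (false, false) => (B ∪ C)ᶜ := by
  rcases i with ⟨_ | _, _ | _⟩ <;> ext a <;> simp [and_comm]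

theorem card_filter_mem_pair_eq {α : Type*} [Fintype α] [DecidableEq α] {B C E D : Finset α}
    (hB : B.card = E.card) (hC : C.card = D.card) (hI : (E ∩ D).card = (B ∩ C).card)
    (i : Bool × Bool) :
    (univ.filter (fun a => (decide (a ∈ B), decide (a ∈ C)) = i)).card =
      (univ.filter (fun a => (decide (a ∈ E), decide (a ∈ D)) = i)).card := by
  have h₁ := card_sdiff_add_card_inter B C
  have h₂ := card_sdiff_add_card_inter C B
  have h₃ := card_sdiff_add_card_inter E D
  have h₄ := card_sdiff_add_card_inter D E
  have h₅ := card_union_add_card_inter B C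
  have h₆ := card_union_add_card_inter E D
  rw [inter_comm C B] at h₂
  rw [inter_comm D E] at h₄
  rw [filter_mem_pair_eq, filter_mem_pair_eq]
  rcases i with ⟨_ | _, _ | _⟩ <;> simp only [card_compl] <;> omega

theorem image_perm_eq_iff {α : Type*} [DecidableEq α] (u : Equiv.Perm α) (C D : Finset α) :
    C.image u = D ↔ ∀ a, u a ∈ D ↔ a ∈ C := by
  constructor
  · rintro rfl a
    simp
  · intro h
    ext b
    obtain ⟨a, rfl⟩ := u.surjective b
    simp [h]

/-- Pairs of permutations with product `w` are determined by their first component. -/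
theorem card_filter_mul_eq {α : Type*} [Fintype α] [DecidableEq α] (A B C D : Finset α)
    (w : Equiv.Perm α) :
    (univ.filter (fun p : Equiv.Perm α × Equiv.Perm α =>
        C.image ⇑p.1 = D ∧ A.image ⇑p.2 = B ∧ p.1 * p.2 = w)).card =
      (univ.filter (fun u : Equiv.Perm α => C.image u = D ∧ B.image u = A.image w)).card := by
  refine card_bij' (fun p _ => p.1) (fun u _ => (u, u⁻¹ * w)) ?_ ?_ ?_ ?_
  · rintro ⟨u, v⟩ h
    simp only [mem_filter_univ] at h ⊢
    obtain ⟨hC, rfl, rfl⟩ := h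
    exact ⟨hC, by rw [image_image, Equiv.Perm.coe_mul]⟩
  · intro u h
    simp only [mem_filter_univ] at h ⊢
    refine ⟨h.1, ?_, mul_inv_cancel_left u w⟩
    rw [Equiv.Perm.coe_mul, ← image_image, ← h.2, image_image, ← Equiv.Perm.coe_mul,
      inv_mul_cancel, Equiv.Perm.coe_one, image_id]
  · rintro ⟨u, v⟩ h
    simp only [mem_filter_univ] at h
    simp [← h.2.2]
  · intro u _
    rfl

/-- For a fixed permutation `w ∈ S_n`, let `Q_w` be the set of pairs
`(u, v) ∈ S_n × S_n` with `u(C) = D`, `v(A) = B` and `uv = w`.  Then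
`|Q_w| = 0` if `|w(A) ∩ D| ≠ |B ∩ C|`, and `|Q_w| = ω_{B,C}` if
`|w(A) ∩ D| = |B ∩ C|`. -/
theorem card_Qw {n : ℕ} (A B C D : Finset (Fin n))
    (hAB : A.card = B.card) (hCD : C.card = D.card) (w : Equiv.Perm (Fin n)) :
    ((A.image ⇑w ∩ D).card ≠ (B ∩ C).card →
      (Finset.univ.filter (fun p : Equiv.Perm (Fin n) × Equiv.Perm (Fin n) =>
        C.image ⇑p.1 = D ∧ A.image ⇑p.2 = B ∧ p.1 * p.2 = w)).card = 0) ∧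
    ((A.image ⇑w ∩ D).card = (B ∩ C).card →
      (Finset.univ.filter (fun p : Equiv.Perm (Fin n) × Equiv.Perm (Fin n) =>
        C.image ⇑p.1 = D ∧ A.image ⇑p.2 = B ∧ p.1 * p.2 = w)).card = omegaBC B C) := by
  rw [card_filter_mul_eq]
  constructor
  · intro hne
    rw [card_eq_zero, filter_eq_empty_iff]
    rintro u - ⟨rfl, hE⟩
    rw [← hE, ← image_inter _ _ u.injective, card_image_of_injective _ u.injective] at hne
    exact hne rfl
  · intro hI
    have hB : B.card = (A.image w).card := by rw [card_image_of_injective _ w.injective, hAB]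
    have key := card_perm_comp_eq _ _ (card_filter_mem_pair_eq hB hCD hI)
    simp only [filter_mem_pair_eq, Fintype.prod_prod_type, Fintype.prod_bool] at key
    rw [omegaBC, mul_assoc _ (C \ B).card.factorial, ← key]
    congr 1
    ext u
    simp only [mem_filter_univ, image_perm_eq_iff, funext_iff, Function.comp_apply, Prod.mk.injEq,
      decide_eq_decide, forall_and]
    exact and_comm
end

section
/- Let D be a subset of [n], and let α = (α_C)_{C ⊆ [n], |C| = |D|} be a family of scalars in k indexed by the |D|-element subsets of [n]. Set ∇_{D,α} := ∑_{C ⊆ [n], |C| = |D|} α_C ∇_{D,C} ∈ k[S_n] and δ_{D,α,m} := ∑_{C ⊆ [n], |C| = |D|} α_C δ_{D,C,m} ∈ k for each m ∈ ℕ. Then (∏_{m=0}^{|D|} (∇_{D,α} − δ_{D,α,m})) · ∇_{D,α} = 0 in k[S_n]. -/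
open Finset

/-- The rectangular rook sum `∇_{B,A} = ∑_{w ∈ S_n, w(A) = B} w` in the group
algebra `k[S_n]`. -/
noncomputable def rookSum (k : Type*) [CommRing k] {n : ℕ} (B A : Finset (Fin n)) :
    MonoidAlgebra k (Equiv.Perm (Fin n)) :=
  ∑ w ∈ Finset.univ.filter (fun w : Equiv.Perm (Fin n) => A.image ⇑w = B),
    MonoidAlgebra.of k (Equiv.Perm (Fin n)) w

/-- The integer `δ_{D,C,m} = ∑_{B ⊆ D, |B| = m} ω_{B,C} (−1)^{m − |B∩C|} binom(m, |B∩C|)`.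
(Note that `|B∩C| ≤ |B| = m`, so the natural-number subtraction `m - |B∩C|` agrees
with the integer difference.) -/
def deltaDCm {n : ℕ} (D C : Finset (Fin n)) (m : ℕ) : ℤ :=
  ∑ B ∈ D.powerset.filter (fun B => B.card = m),
    (omegaBC B C : ℤ) * (-1 : ℤ) ^ (m - (B ∩ C).card) * (m.choose ((B ∩ C).card) : ℤ)

/-- `∇_{D,α} = ∑_{C ⊆ [n], |C| = |D|} α_C ∇_{D,C}`. -/
noncomputable def nablaDalpha (k : Type*) [CommRing k] {n : ℕ} (D : Finset (Fin n))
    (α : Finset (Fin n) → k) : MonoidAlgebra k (Equiv.Perm (Fin n)) :=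
  ∑ C ∈ Finset.univ.filter (fun C : Finset (Fin n) => C.card = D.card),
    α C • rookSum k D C

/-- `δ_{D,α,m} = ∑_{C ⊆ [n], |C| = |D|} α_C δ_{D,C,m} ∈ k`. -/
noncomputable def deltaDalpham (k : Type*) [CommRing k] {n : ℕ} (D : Finset (Fin n))
    (α : Finset (Fin n) → k) (m : ℕ) : k :=
  ∑ C ∈ Finset.univ.filter (fun C : Finset (Fin n) => C.card = D.card),
    α C * ((deltaDCm D C m : ℤ) : k)

/-- Permutations carrying the labelling `g` to the labelling `f` are counted by the product of the
factorials of the fiber sizes, provided that the fibers of `f` and `g` match in size. -/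
theorem Equiv.Perm.card_comp_eq {α ι : Type*} [Fintype α] [DecidableEq α] [Fintype ι]
    [DecidableEq ι] {f g : α → ι}
    (h : ∀ i, Fintype.card {a // f a = i} = Fintype.card {a // g a = i}) :
    #{u : Equiv.Perm α | g ∘ u = f} = ∏ i, (Fintype.card {a // f a = i}).factorial := by
  let e : Equiv.Perm α := Equiv.ofFiberEquiv fun i => Fintype.equivOfCardEq (h i)
  have he : g ∘ e = f := funext fun a => Equiv.ofFiberEquiv_map _ a
  rw [← DomMulAct.stabilizer_card f, Fintype.card_subtype]
  refine Finset.card_bij' (fun u _ => e⁻¹ * u) (fun u _ => e * u) ?_ ?_ ?_ ?_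
  · intro u hu
    simp only [mem_filter, mem_univ, true_and] at hu ⊢
    funext a
    rw [← congrFun hu a]
    simpa using (congrFun he (e⁻¹ (u a))).symm
  · intro u hu
    simp only [mem_filter, mem_univ, true_and] at hu ⊢
    rw [Equiv.Perm.coe_mul, ← Function.comp_assoc, he, hu]
  · simp
  · simp

theorem card_perm_image_eq_and_image_eq {n : ℕ} {B C D E : Finset (Fin n)}
    (hCD : #C = #D) (hBE : #B = #E) (h : #(B ∩ C) = #(E ∩ D)) :
    #{u : Equiv.Perm (Fin n) | C.image u = D ∧ B.image u = E} = omegaBC B C := by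
  let label (X Y : Finset (Fin n)) (a : Fin n) : Bool × Bool := (decide (a ∈ X), decide (a ∈ Y))
  have hiff (X Y : Finset (Fin n)) (hXY : #X = #Y) (u : Equiv.Perm (Fin n)) :
      X.image u = Y ↔ ∀ a, u a ∈ Y ↔ a ∈ X := by
    constructor
    · rintro rfl a
      simp
    · intro hu
      refine Finset.eq_of_subset_of_card_le (fun y hy => ?_) ?_
      · obtain ⟨a, ha, rfl⟩ := mem_image.1 hy
        exact (hu a).2 ha
      · rw [card_image_of_injective _ u.injective, hXY]
  have hset (u : Equiv.Perm (Fin n)) :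
      C.image u = D ∧ B.image u = E ↔ label E D ∘ u = label B C := by
    simp only [hiff _ _ hCD, hiff _ _ hBE, funext_iff, label,
      Function.comp_apply, Prod.mk.injEq, decide_eq_decide, forall_and]
    tauto
  have hfib (X Y : Finset (Fin n)) :
      Fintype.card {a // label X Y a = (true, true)} = #(X ∩ Y) ∧
      Fintype.card {a // label X Y a = (true, false)} = #(X \ Y) ∧
      Fintype.card {a // label X Y a = (false, true)} = #(Y \ X) ∧
      Fintype.card {a // label X Y a = (false, false)} = #(X ∪ Y)ᶜ := by
    refine ⟨?_, ?_, ?_, ?_⟩ <;> rw [Fintype.card_subtype] <;> congr 1 <;> ext a <;>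
      simp [label]
    all_goals tauto
  have h1 := card_inter_add_card_sdiff B C
  have h2 := card_inter_add_card_sdiff E D
  have h3 := card_inter_add_card_sdiff C B
  have h4 := card_inter_add_card_sdiff D E
  have h5 := card_union_add_card_inter B C
  have h6 := card_union_add_card_inter E D
  rw [inter_comm] at h3 h4
  obtain ⟨p1, p2, p3, p4⟩ := hfib B C
  obtain ⟨q1, q2, q3, q4⟩ := hfib E D
  simp only [hset]
  rw [Equiv.Perm.card_comp_eq]
  · simp only [Fintype.prod_prod_type, Fintype.prod_bool, p1, p2, p3, p4, omegaBC]
    ring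
  · rintro ⟨_ | _, _ | _⟩
    · rw [p4, q4, card_compl, card_compl]
      omega
    · rw [p3, q3]
      omega
    · rw [p2, q2]
      omega
    · rw [p1, q1, h]

/-- Binomial inversion, summed over the subsets of a finite set. -/
theorem Finset.sum_powerset_neg_one_pow_mul_choose {β : Type*} (s : Finset β) (r : ℕ) :
    ∑ V ∈ s.powerset, (-1 : ℤ) ^ (#V - r) * ((#V).choose r : ℤ) = if r = #s then 1 else 0 := by
  rw [sum_powerset_apply_card (fun j => (-1 : ℤ) ^ (j - r) * (j.choose r : ℤ))]
  generalize #s = t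
  rcases lt_or_ge t r with h | h
  · rw [if_neg h.ne']
    refine sum_eq_zero fun j hj => ?_
    rw [Nat.choose_eq_zero_of_lt (by simp at hj; omega : j < r)]
    simp
  · obtain ⟨d, rfl⟩ := Nat.exists_eq_add_of_le h
    rw [add_assoc, sum_range_add, sum_eq_zero, zero_add]
    · have key (i : ℕ) : (r + d).choose (r + i) • ((-1 : ℤ) ^ (r + i - r) *
          ((r + i).choose r : ℤ)) = ((r + d).choose r : ℤ) * ((-1) ^ i * (d.choose i : ℤ)) := by
        have := Nat.choose_mul (n := r + d) (Nat.le_add_right r i)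
        simp only [Nat.add_sub_cancel_left] at this ⊢
        have := congrArg (Nat.cast : ℕ → ℤ) this
        push_cast at this
        rw [nsmul_eq_mul]
        linear_combination (-1) ^ i * this
      simp only [key, ← mul_sum, Int.alternating_sum_range_choose]
      rcases eq_or_ne d 0 with rfl | hd
      · simp
      · simp [hd]
    · intro j hj
      rw [Nat.choose_eq_zero_of_lt (mem_range.1 hj)]
      simp

/-- The sum of all permutations `w` with `w(A) ⊆ D`. -/
noncomputable def subsetRookSum (k : Type*) [CommRing k] {n : ℕ} (D A : Finset (Fin n)) :
    MonoidAlgebra k (Equiv.Perm (Fin n)) :=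
  ∑ w ∈ Finset.univ.filter (fun w : Equiv.Perm (Fin n) => A.image w ⊆ D),
    MonoidAlgebra.of k (Equiv.Perm (Fin n)) w

section

variable (k : Type*) [CommRing k] {n : ℕ}

theorem subsetRookSum_eq_sum_rookSum (D A : Finset (Fin n)) :
    subsetRookSum k D A = ∑ B ∈ D.powerset.filter (fun B => #B = #A), rookSum k B A := by
  simp only [subsetRookSum, rookSum, sum_filter (s := (univ : Finset (Equiv.Perm (Fin n))))]
  rw [sum_comm]
  refine sum_congr rfl fun w _ => ?_
  rw [sum_ite_eq]
  simp [card_image_of_injective _ w.injective]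

theorem subsetRookSum_of_card_eq {D C : Finset (Fin n)} (h : #C = #D) :
    subsetRookSum k D C = rookSum k D C := by
  unfold subsetRookSum rookSum
  congr 1
  ext w
  simp only [mem_filter, mem_univ, true_and]
  exact ⟨fun hw => eq_of_subset_of_card_le hw
    (by rw [card_image_of_injective _ w.injective, h]), fun hw => hw.subset⟩

/-- The product rule for rectangular rook sums. -/
theorem rookSum_mul_rookSum {A B C D : Finset (Fin n)} (hAB : #A = #B) (hCD : #C = #D) :
    rookSum k D C * rookSum k B A = ∑ V ∈ A.powerset,
      (((omegaBC B C : ℤ) * (-1) ^ (#V - #(B ∩ C)) * ((#V).choose #(B ∩ C) : ℤ) : ℤ) : k) •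
        subsetRookSum k D V := by
  have hl : rookSum k D C * rookSum k B A = ∑ w : Equiv.Perm (Fin n),
      ((#{u : Equiv.Perm (Fin n) | C.image u = D ∧ B.image u = A.image w} : ℕ) : k) •
        MonoidAlgebra.of k (Equiv.Perm (Fin n)) w := by
    have hinner (u : Equiv.Perm (Fin n)) : MonoidAlgebra.of k (Equiv.Perm (Fin n)) u * rookSum k B A =
        ∑ w : Equiv.Perm (Fin n), if B.image u = A.image w then
          MonoidAlgebra.of k (Equiv.Perm (Fin n)) w else 0 := by
      rw [rookSum, mul_sum, sum_filter]
      refine Fintype.sum_equiv (Equiv.mulLeft u) _ _ fun v => ?_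
      have : A.image v = B ↔ B.image u = A.image (u * v : Equiv.Perm (Fin n)) := by
        rw [Equiv.Perm.coe_mul, ← image_image, (image_injective u.injective).eq_iff, eq_comm]
      simp only [Equiv.coe_mulLeft, ← this, map_mul]
    rw [rookSum, sum_mul]
    simp only [hinner]
    rw [sum_comm]
    refine sum_congr rfl fun w _ => ?_
    rw [← sum_filter, filter_filter, sum_const, Nat.cast_smul_eq_nsmul]
  rw [hl]
  simp only [subsetRookSum, sum_filter, smul_sum]
  rw [sum_comm]
  refine sum_congr rfl fun w _ => ?_
  have hpow : (A.powerset.filter fun V => V.image w ⊆ D) =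
      (A.filter fun a => w a ∈ D).powerset := by
    ext V
    simp only [mem_filter, mem_powerset, subset_iff, mem_image, forall_exists_index, and_imp,
      forall_apply_eq_imp_iff₂, forall_and]
  have hcard : #(A.filter fun a => w a ∈ D) = #(A.image w ∩ D) := by
    rw [← card_image_of_injective _ w.injective, ← filter_mem_eq_inter, filter_image]
  simp only [smul_ite, smul_zero]
  rw [← sum_filter, hpow, ← sum_smul, ← Int.cast_sum]
  simp only [mul_assoc]
  rw [← mul_sum, sum_powerset_neg_one_pow_mul_choose, hcard]
  congr 1
  split_ifs with h
  · rw [card_perm_image_eq_and_image_eq hCD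
      (by rw [card_image_of_injective _ w.injective, hAB]) h]
    simp
  · rw [card_eq_zero.2]
    · simp
    · refine filter_eq_empty_iff.2 fun u _ hu => h ?_
      rw [← hu.1, ← hu.2, ← image_inter _ _ u.injective,
        card_image_of_injective _ u.injective]

theorem nablaDalpha_mul_subsetRookSum (D A : Finset (Fin n)) (α : Finset (Fin n) → k) :
    ∃ c : Finset (Fin n) → k, nablaDalpha k D α * subsetRookSum k D A =
      deltaDalpham k D α #A • subsetRookSum k D A +
        ∑ V ∈ A.ssubsets, c V • subsetRookSum k D V := by
  let c (V : Finset (Fin n)) : k := ∑ C ∈ univ.filter (fun C : Finset (Fin n) => #C = #D), α C *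
    ((∑ B ∈ D.powerset.filter (fun B => #B = #A),
      (omegaBC B C : ℤ) * (-1) ^ (#V - #(B ∩ C)) * ((#V).choose #(B ∩ C) : ℤ) : ℤ) : k)
  refine ⟨c, ?_⟩
  have hA : deltaDalpham k D α #A = c A := rfl
  rw [hA, ssubsets, add_sum_erase _ (fun V => c V • subsetRookSum k D V) (mem_powerset_self A),
    nablaDalpha, sum_mul]
  simp only [c, sum_smul]
  rw [sum_comm]
  refine sum_congr rfl fun C hC => ?_
  simp only [mem_filter, mem_univ, true_and] at hC
  rw [subsetRookSum_eq_sum_rookSum k D A, mul_sum]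
  simp only [mul_smul, Int.cast_sum, sum_smul]
  rw [← smul_sum, sum_comm, smul_sum]
  refine sum_congr rfl fun B hB => ?_
  rw [smul_mul_assoc, rookSum_mul_rookSum k (mem_filter.1 hB).2.symm hC]

/-- The span of the sums `subsetRookSum k D V` with `#V < m`. -/
noncomputable def rookFiltration (D : Finset (Fin n)) (m : ℕ) :
    Submodule k (MonoidAlgebra k (Equiv.Perm (Fin n))) :=
  Submodule.span k (subsetRookSum k D '' {V | #V < m})

theorem subsetRookSum_mem_rookFiltration {D V : Finset (Fin n)} {m : ℕ} (h : #V < m) :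
    subsetRookSum k D V ∈ rookFiltration k D m :=
  Submodule.subset_span ⟨V, h, rfl⟩

theorem nablaDalpha_sub_mul_mem_rookFiltration (D : Finset (Fin n)) (α : Finset (Fin n) → k)
    (m : ℕ) {x : MonoidAlgebra k (Equiv.Perm (Fin n))} (hx : x ∈ rookFiltration k D (m + 1)) :
    (nablaDalpha k D α - deltaDalpham k D α m • 1) * x ∈ rookFiltration k D m := by
  induction hx using Submodule.span_induction with
  | zero => simp
  | add x y _ _ hx hy =>
    rw [mul_add]
    exact add_mem hx hy
  | smul a x _ hx =>
    rw [mul_smul_comm]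
    exact Submodule.smul_mem _ a hx
  | mem x hx =>
    obtain ⟨A, hA : #A < m + 1, rfl⟩ := hx
    obtain ⟨c, hc⟩ := nablaDalpha_mul_subsetRookSum k D A α
    rw [sub_mul, smul_one_mul, hc, add_sub_right_comm, ← sub_smul]
    refine add_mem ?_ (Submodule.sum_mem _ fun V hV => Submodule.smul_mem _ _
      (subsetRookSum_mem_rookFiltration k ?_))
    · rcases Nat.lt_succ_iff_lt_or_eq.1 hA with h | rfl
      · exact Submodule.smul_mem _ _ (subsetRookSum_mem_rookFiltration k h)
      · simp
    · have := card_lt_card (mem_ssubsets.1 hV)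
      omega

theorem prod_nablaDalpha_sub_mul_eq_zero (D : Finset (Fin n)) (α : Finset (Fin n) → k) (m : ℕ)
    {x : MonoidAlgebra k (Equiv.Perm (Fin n))} (hx : x ∈ rookFiltration k D m) :
    ((List.range m).map fun i => nablaDalpha k D α -
      deltaDalpham k D α i • (1 : MonoidAlgebra k (Equiv.Perm (Fin n)))).prod * x = 0 := by
  induction m generalizing x with
  | zero => simpa [rookFiltration] using hx
  | succ m ih =>
    rw [List.prod_range_succ, mul_assoc]
    exact ih (nablaDalpha_sub_mul_mem_rookFiltration k D α m hx)

theorem nablaDalpha_mem_rookFiltration (D : Finset (Fin n)) (α : Finset (Fin n) → k) :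
    nablaDalpha k D α ∈ rookFiltration k D (#D + 1) := by
  refine Submodule.sum_mem _ fun C hC => Submodule.smul_mem _ _ ?_
  have hC := (mem_filter.1 hC).2
  rw [← subsetRookSum_of_card_eq k hC]
  exact subsetRookSum_mem_rookFiltration k (by omega)

end

/-- Theorem (triangularity): `(∏_{m=0}^{|D|} (∇_{D,α} − δ_{D,α,m})) ∇_{D,α} = 0`,
where `δ_{D,α,m}` is identified with the scalar multiple `δ_{D,α,m} • 1` of the
identity of `k[S_n]` (the product is taken in the stated order; all factors
commute anyway). -/
theorem nablaDalpha_triangular {n : ℕ} (k : Type*) [CommRing k] (D : Finset (Fin n))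
    (α : Finset (Fin n) → k) :
    (((List.range (D.card + 1)).map (fun m =>
        nablaDalpha k D α -
          deltaDalpham k D α m • (1 : MonoidAlgebra k (Equiv.Perm (Fin n))))).prod) *
      nablaDalpha k D α = 0 := by
  exact prod_nablaDalpha_sub_mul_eq_zero k D α _ (nablaDalpha_mem_rookFiltration k D α)
end
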